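/- arXiv:2506.13924 — 3 statements merged into one kernel-verified Lean document; each statement's English description precedes it below -/
import Mathlib

section
/- Let Λ be a non-abelian subgroup of Sol and set Λ₀ := Λ ∩ T. Then either Λ₀ is discrete, in which case Λ is a discrete cocompact subgroup of Sol (the quotient Sol/Λ is compact) with Λ₀ isomorphic to ℤ² and Λ/Λ₀ isomorphic to ℤ (so Λ ≅ ℤ ⋉ ℤ²); or Λ₀ is non-discrete (has an accumulation point), and in the latter case either Λ₀ is dense in T or Λ is contained in a copy of Aff(ℝ). -/
open Matrix

noncomputable section

/-- A local abbreviation for `GL₃(ℝ)`, with its topology induced from the space of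
`3 × 3` real matrices. -/
abbrev GL3 : Type := Matrix.GeneralLinearGroup (Fin 3) ℝ

/-- The matrix `[[λ,0,a],[0,λ⁻¹,b],[0,0,1]]`. -/
def solMat (l a b : ℝ) : Matrix (Fin 3) (Fin 3) ℝ :=
  !![l, 0, a; 0, l⁻¹, b; 0, 0, 1]

/-- `Sol = SO°(1,1) ⋉ ℝ²`, as the set of matrices `[[λ,0,a],[0,λ⁻¹,b],[0,0,1]]` with
`λ > 0`, inside `GL₃(ℝ)`. -/
def SolSet : Set GL3 :=
  {g | ∃ l a b : ℝ, 0 < l ∧ (g : Matrix (Fin 3) (Fin 3) ℝ) = solMat l a b}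

/-- The translation subgroup `T = {λ = 1} ≅ ℝ²` of `Sol`. -/
def TSet : Set GL3 :=
  {g | ∃ a b : ℝ, (g : Matrix (Fin 3) (Fin 3) ℝ) = solMat 1 a b}

/-- The subgroup `A₁ = {b = 0}` of `Sol`, a copy of `Aff(ℝ)`. -/
def A1Set : Set GL3 :=
  {g | ∃ l a : ℝ, 0 < l ∧ (g : Matrix (Fin 3) (Fin 3) ℝ) = solMat l a 0}

/-- The subgroup `A₂ = {a = 0}` of `Sol`, a copy of `Aff(ℝ)`. -/
def A2Set : Set GL3 :=
  {g | ∃ l b : ℝ, 0 < l ∧ (g : Matrix (Fin 3) (Fin 3) ℝ) = solMat l 0 b}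

namespace SolAux

open Real

/-- The element of `Sol` with parameters `exp t, a, b`. -/
def E (t a b : ℝ) : GL3 :=
  ⟨solMat (exp t) a b, solMat (exp (-t)) (-(exp (-t) * a)) (-(exp t * b)),
    by
      have h : exp t * exp (-t) = 1 := by rw [← exp_add]; simp
      have h0 := (exp_pos t).ne'
      ext i j
      fin_cases i <;> fin_cases j <;>
        simp [solMat, Matrix.mul_apply, Fin.sum_univ_three, exp_neg],
    by
      have h : exp t * exp (-t) = 1 := by rw [← exp_add]; simp
      have h0 := (exp_pos t).ne'
      ext i j
      fin_cases i <;> fin_cases j <;>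
        simp [solMat, Matrix.mul_apply, Fin.sum_univ_three, exp_neg]⟩

theorem E_val (t a b : ℝ) : (E t a b : Matrix (Fin 3) (Fin 3) ℝ) = solMat (exp t) a b := rfl

theorem E_mul (t a b s c d : ℝ) :
    E t a b * E s c d = E (t + s) (exp t * c + a) (exp (-t) * d + b) := by
  apply Units.ext
  rw [Units.val_mul, E_val, E_val, E_val]
  ext i j
  fin_cases i <;> fin_cases j <;>
    simp [solMat, Matrix.mul_apply, Fin.sum_univ_three, exp_neg, exp_add, mul_comm]

theorem E_zero : E 0 0 0 = 1 := by
  apply Units.ext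
  rw [E_val]
  ext i j
  fin_cases i <;> fin_cases j <;> simp [solMat]

theorem E_inv (t a b : ℝ) : (E t a b)⁻¹ = E (-t) (-(exp (-t) * a)) (-(exp t * b)) := by
  apply inv_eq_of_mul_eq_one_right
  have h : exp t * exp (-t) = 1 := by rw [← exp_add]; simp
  rw [E_mul, ← E_zero]
  congr 1
  · ring
  · linear_combination (-a) * h
  · linear_combination (-b) * h

theorem E_inj {t a b s c d : ℝ} (h : E t a b = E s c d) : t = s ∧ a = c ∧ b = d := by
  have h' : solMat (exp t) a b = solMat (exp s) c d := by rw [← E_val, h, E_val]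
  refine ⟨?_, ?_, ?_⟩
  · have := congrFun (congrFun h' 0) 0
    simpa [solMat] using this
  · have := congrFun (congrFun h' 0) 2
    simpa [solMat] using this
  · have := congrFun (congrFun h' 1) 2
    simpa [solMat] using this

theorem E_mem (t a b : ℝ) : E t a b ∈ SolSet := ⟨exp t, a, b, exp_pos t, rfl⟩

theorem mem_sol {g : GL3} (h : g ∈ SolSet) : ∃ t a b, g = E t a b := by
  obtain ⟨l, a, b, hl, h⟩ := h
  exact ⟨log l, a, b, Units.ext (by rw [h, E_val, exp_log hl])⟩

theorem E_memT (t a b : ℝ) : E t a b ∈ TSet ↔ t = 0 := by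
  constructor
  · rintro ⟨c, d, h⟩
    have := congrFun (congrFun h 0) 0
    simpa [solMat, E_val] using this
  · rintro rfl
    exact ⟨a, b, by rw [E_val, exp_zero]⟩

theorem mem_T {g : GL3} (h : g ∈ TSet) : ∃ a b, g = E 0 a b := by
  obtain ⟨a, b, h⟩ := h
  exact ⟨a, b, Units.ext (by rw [h, E_val, exp_zero])⟩

theorem continuous_solMat {X : Type*} [TopologicalSpace X] {f g h : X → ℝ}
    (hf : Continuous f) (hf0 : ∀ x, f x ≠ 0) (hg : Continuous g) (hh : Continuous h) :
    Continuous (fun x => solMat (f x) (g x) (h x)) := by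
  apply continuous_matrix
  intro i j
  have := hf.inv₀ hf0
  fin_cases i <;> fin_cases j <;> simp [solMat] <;> first | assumption | fun_prop

theorem E_cont : Continuous (fun p : ℝ × ℝ × ℝ => E p.1 p.2.1 p.2.2) := by
  rw [Units.continuous_iff]
  constructor
  · apply continuous_solMat
    · fun_prop
    · intro x; exact (exp_pos _).ne'
    · fun_prop
    · fun_prop
  · apply continuous_solMat
    · fun_prop
    · intro x; exact (exp_pos _).ne'
    · fun_prop
    · fun_prop

/-- translations -/
def S (Λ : Subgroup GL3) : AddSubgroup (ℝ × ℝ) where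
  carrier := {p | E 0 p.1 p.2 ∈ Λ}
  zero_mem' := by simp [E_zero, Λ.one_mem]
  add_mem' := by
    intro p q hp hq
    have := Λ.mul_mem hp hq
    rw [E_mul] at this
    simpa [add_comm] using this
  neg_mem' := by
    intro p hp
    have := Λ.inv_mem hp
    rw [E_inv] at this
    simpa using this

theorem mem_S {Λ : Subgroup GL3} {a b : ℝ} : (a, b) ∈ S Λ ↔ E 0 a b ∈ Λ := Iff.rfl

/-- logs of dilation factors -/
def L (Λ : Subgroup GL3) : AddSubgroup ℝ where
  carrier := {t | ∃ a b, E t a b ∈ Λ}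
  zero_mem' := ⟨0, 0, by simp [E_zero, Λ.one_mem]⟩
  add_mem' := by
    rintro p q ⟨a, b, hp⟩ ⟨c, d, hq⟩
    have := Λ.mul_mem hp hq
    rw [E_mul] at this
    exact ⟨_, _, this⟩
  neg_mem' := by
    rintro p ⟨a, b, hp⟩
    have := Λ.inv_mem hp
    rw [E_inv] at this
    exact ⟨_, _, this⟩

theorem mem_L {Λ : Subgroup GL3} {t : ℝ} : t ∈ L Λ ↔ ∃ a b, E t a b ∈ Λ := Iff.rfl

theorem act {Λ : Subgroup GL3} {t p q : ℝ} (ht : t ∈ L Λ) (h : (p, q) ∈ S Λ) :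
    (exp t * p, exp (-t) * q) ∈ S Λ := by
  obtain ⟨a, b, ht⟩ := ht
  have := Λ.mul_mem (Λ.mul_mem ht h) (Λ.inv_mem ht)
  have e : exp t * exp (-t) = 1 := by rw [← exp_add]; simp
  rw [E_inv, E_mul, E_mul] at this
  rw [mem_S]
  convert this using 2
  · ring
  · simp only [add_zero]
    linear_combination a * e
  · simp only [add_zero]
    linear_combination b * e

theorem comm_mem {Λ : Subgroup GL3} {t a b s c d : ℝ} (h1 : E t a b ∈ Λ) (h2 : E s c d ∈ Λ) :
    (exp t * c + a - (exp s * a + c), exp (-t) * d + b - (exp (-s) * b + d)) ∈ S Λ := by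
  have := Λ.mul_mem (Λ.mul_mem h1 h2) (Λ.inv_mem (Λ.mul_mem h2 h1))
  have e : exp t * exp (-t) = 1 := by rw [← exp_add]; simp
  have e' : exp s * exp (-s) = 1 := by rw [← exp_add]; simp
  rw [E_mul, E_mul, E_inv, E_mul] at this
  rw [mem_S]
  have k : ∀ x : ℝ, exp (t + s) * (exp (-(s + t)) * x) = x := by
    intro x
    rw [← mul_assoc, ← exp_add, add_comm s t]
    simp
  have k' : ∀ x : ℝ, exp (-(t + s)) * (exp (s + t) * x) = x := by
    intro x
    rw [← mul_assoc, ← exp_add, add_comm s t]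
    simp
  convert this using 2
  · ring
  · rw [mul_neg, k]; ring
  · rw [mul_neg, k']; ring

/-- the invariance property -/
def Inv (t : ℝ) (H : AddSubgroup (ℝ × ℝ)) : Prop :=
  ∀ n : ℤ, ∀ p q : ℝ, (p, q) ∈ H → (exp (n * t) * p, exp (-(n * t)) * q) ∈ H

theorem inv_S {Λ : Subgroup GL3} {t : ℝ} (ht : t ∈ L Λ) : Inv t (S Λ) := by
  intro n p q h
  apply act _ h
  simpa using (L Λ).zsmul_mem ht n

theorem inv_closure {t : ℝ} {H : AddSubgroup (ℝ × ℝ)} (h : Inv t H) :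
    Inv t H.topologicalClosure := by
  intro n p q hpq
  have hc : Continuous (fun z : ℝ × ℝ => (exp (n * t) * z.1, exp (-(n * t)) * z.2)) := by fun_prop
  exact map_mem_closure (f := fun z : ℝ × ℝ => (exp (n * t) * z.1, exp (-(n * t)) * z.2))
    hc hpq (fun z hz => h n z.1 z.2 hz)

theorem exp_int_mul' (t : ℝ) (n : ℤ) : exp (n * t) = exp t ^ n := by
  rw [mul_comm, Real.exp_mul, Real.rpow_intCast]

theorem axisX {t : ℝ} (ht : 0 < t) (H : AddSubgroup (ℝ × ℝ)) (hc : IsClosed (H : Set (ℝ × ℝ)))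
    (hi : Inv t H) (hs : ∀ ε > 0, ∃ p q : ℝ, (p, q) ∈ H ∧ |p| < ε ∧ |q| < ε ∧ p ≠ 0) (x : ℝ) :
    (x, 0) ∈ H := by
  have : ((x, 0) : ℝ × ℝ) ∈ closure (H : Set (ℝ × ℝ)) := by
    rw [Metric.mem_closure_iff]
    intro δ hδ
    set r := δ / 2 / exp t with hr
    have hrpos : 0 < r := by positivity
    set B := |x| / r + 1 with hB
    have hBpos : 0 < B := by positivity
    obtain ⟨p, q, hpq, hp, hq, hp0⟩ := hs (min 1 (r * δ / (2 * B))) (by positivity)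
    have hp1 : |p| < 1 := lt_of_lt_of_le hp (min_le_left _ _)
    have hq1 : |q| < r * δ / (2 * B) := lt_of_lt_of_le hq (min_le_right _ _)
    have hpp : 0 < |p| := abs_pos.mpr hp0
    obtain ⟨n, hn⟩ := exists_mem_Ioc_zpow (x := |p| / r) (y := exp t) (by positivity)
      (by simpa using ht)
    rw [← exp_int_mul', ← exp_int_mul'] at hn
    obtain ⟨hn1, hn2⟩ := hn
    have hmem := hi (-n) p q hpq
    set P := exp (((-n : ℤ) : ℝ) * t) * p with hP
    set Q := exp (-(((-n : ℤ) : ℝ) * t)) * q with hQ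
    have e0 : exp (-(n * t)) * exp (n * t) = 1 := by rw [← exp_add]; simp
    have hPa : |P| = exp (-(n * t)) * |p| := by
      rw [hP, abs_mul, abs_of_pos (exp_pos _)]; simp
    have hQa : |Q| = exp (n * t) * |q| := by
      rw [hQ, abs_mul, abs_of_pos (exp_pos _)]; simp
    have hP1 : r < |P| := by
      rw [hPa]
      rw [lt_div_iff₀ hrpos] at hn1
      calc r = exp (-(n * t)) * (exp (n * t) * r) := by rw [← mul_assoc, e0, one_mul]
        _ < _ := by gcongr
    have hP2 : |P| ≤ δ / 2 := by
      rw [hPa]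
      rw [div_le_iff₀ hrpos] at hn2
      calc _ ≤ exp (-(n * t)) * (exp (((n + 1 : ℤ) : ℝ) * t) * r) := by gcongr
        _ = (exp (-(n * t)) * exp (n * t)) * (exp t * r) := by
            push_cast
            rw [add_mul, exp_add, one_mul]; ring
        _ = _ := by rw [e0, hr]; field_simp
    have hQ1 : |Q| < δ / (2 * B) := by
      rw [hQa]
      have h3 : exp (n * t) < 1 / r := lt_of_lt_of_le hn1 (by gcongr)
      calc _ ≤ 1 / r * |q| := by gcongr
        _ < 1 / r * (r * δ / (2 * B)) := by gcongr
        _ = _ := by field_simp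
    have hP0 : P ≠ 0 := by
      intro h; rw [h, abs_zero] at hP1; linarith
    set m := round (x / P) with hm
    have hmm := H.zsmul_mem hmem m
    refine ⟨_, hmm, ?_⟩
    have h5 := abs_sub_round (x / P)
    rw [← hm] at h5
    have h6 : |x - m * P| ≤ δ / 4 := by
      have : x - m * P = (x / P - m) * P := by field_simp
      rw [this, abs_mul]
      calc _ ≤ 1 / 2 * (δ / 2) := by gcongr
        _ = _ := by ring
    have h7 : |(m : ℝ)| ≤ B := by
      have : |(m : ℝ)| ≤ |x / P| + |x / P - m| := by
        have := abs_sub (x / P) (x / P - m)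
        simpa using this
      have h8 : |x / P| ≤ |x| / r := by
        rw [abs_div]
        gcongr
      rw [hB]; linarith
    have h9 : |m * Q| < δ := by
      rw [abs_mul]
      calc _ ≤ B * |Q| := by gcongr
        _ < B * (δ / (2 * B)) := by gcongr
        _ = δ / 2 := by field_simp
        _ < δ := by linarith
    rw [Prod.dist_eq]
    simp only [Prod.smul_mk, zsmul_eq_mul, Real.dist_eq, zero_sub, abs_neg]
    exact max_lt (by linarith) h9
  rwa [hc.closure_eq] at this

theorem axisY {t : ℝ} (ht : 0 < t) (H : AddSubgroup (ℝ × ℝ)) (hc : IsClosed (H : Set (ℝ × ℝ)))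
    (hi : Inv t H) (hs : ∀ ε > 0, ∃ p q : ℝ, (p, q) ∈ H ∧ |p| < ε ∧ |q| < ε ∧ q ≠ 0) (y : ℝ) :
    (0, y) ∈ H := by
  have := axisX ht (H.comap (AddEquiv.prodComm (M := ℝ) (N := ℝ)).toAddMonoidHom)
    (hc.preimage continuous_swap) (by
      intro n p q h
      have := hi (-n) q p h
      simpa using this) (by
      intro ε hε
      obtain ⟨p, q, h, h1, h2, h3⟩ := hs ε hε
      exact ⟨q, p, h, h2, h1, h3⟩) y
  exact this

theorem exists_small {t : ℝ} (ht : 0 < t) (b : ℝ) (hb : b ≠ 0) {ε : ℝ} (hε : 0 < ε) :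
    ∃ n : ℤ, |exp (-(n * t)) * b| < ε := by
  obtain ⟨n, hn⟩ := exists_mem_Ioc_zpow (x := |b| / ε) (y := exp t)
    (by have := abs_pos.mpr hb; positivity) (by simpa using ht)
  refine ⟨n + 2, ?_⟩
  have h := lt_of_le_of_lt hn.2 (zpow_lt_zpow_right₀ (a := exp t) (by simpa using ht)
    (show n + 1 < n + 2 by omega))
  rw [← exp_int_mul', div_lt_iff₀ hε] at h
  rw [abs_mul, abs_of_pos (exp_pos _)]
  calc _ < exp (-(((n + 2 : ℤ) : ℝ) * t)) * (exp (((n + 2 : ℤ) : ℝ) * t) * ε) := by gcongr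
    _ = ε := by rw [← mul_assoc, ← exp_add]; simp

theorem smallY {t : ℝ} (ht : 0 < t) (H : AddSubgroup (ℝ × ℝ)) (hi : Inv t H) (b : ℝ) (hb : b ≠ 0)
    (h : (0, b) ∈ H) : ∀ ε > 0, ∃ p q : ℝ, (p, q) ∈ H ∧ |p| < ε ∧ |q| < ε ∧ q ≠ 0 := by
  intro ε hε
  obtain ⟨n, hn⟩ := exists_small ht b hb hε
  exact ⟨_, _, hi n _ _ h, by simpa using hε, hn, mul_ne_zero (exp_pos _).ne' hb⟩

theorem smallX {t : ℝ} (ht : 0 < t) (H : AddSubgroup (ℝ × ℝ)) (hi : Inv t H) (b : ℝ) (hb : b ≠ 0)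
    (h : (b, 0) ∈ H) : ∀ ε > 0, ∃ p q : ℝ, (p, q) ∈ H ∧ |p| < ε ∧ |q| < ε ∧ p ≠ 0 := by
  intro ε hε
  obtain ⟨n, hn⟩ := exists_small ht b hb hε
  exact ⟨_, _, hi (-n) _ _ h, by simpa using hn, by simpa using hε, mul_ne_zero (exp_pos _).ne' hb⟩

theorem dense_all {t : ℝ} (ht : 0 < t) (H : AddSubgroup (ℝ × ℝ))
    (hc : IsClosed (H : Set (ℝ × ℝ))) (hi : Inv t H) (a b : ℝ) (ha : a ≠ 0) (hb : b ≠ 0)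
    (hab : (a, b) ∈ H)
    (hs : ∀ ε > 0, ∃ p q : ℝ, (p, q) ∈ H ∧ |p| < ε ∧ |q| < ε ∧ (p, q) ≠ 0) (z : ℝ × ℝ) :
    z ∈ H := by
  have key : (∀ x, (x, 0) ∈ H) ∧ (∀ y, (0, y) ∈ H) := by
    by_cases hx : ∀ ε > 0, ∃ p q : ℝ, (p, q) ∈ H ∧ |p| < ε ∧ |q| < ε ∧ p ≠ 0
    · have hX := axisX ht H hc hi hx
      refine ⟨hX, axisY ht H hc hi (smallY ht H hi b hb ?_)⟩
      simpa using H.sub_mem hab (hX a)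
    · push Not at hx
      obtain ⟨ε, hε, hx⟩ := hx
      have hY := axisY ht H hc hi (by
        obtain ⟨p, q, h, h1, h2, h3⟩ := hs ε hε
        have hp := hx p q h h1 h2
        subst hp
        exact smallY ht H hi q (by simpa using h3) h)
      refine ⟨axisX ht H hc hi (smallX ht H hi a ha ?_), hY⟩
      simpa using H.sub_mem hab (hY b)
  simpa using H.add_mem (key.1 z.1) (key.2 z.2)

theorem conjA1 {Λ : Subgroup GL3} (hΛSol : (Λ : Set GL3) ⊆ SolSet) {t : ℝ} (ht : 0 < t)
    (htL : t ∈ L Λ) (h : ∀ p q, (p, q) ∈ S Λ → q = 0) :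
    ∃ g ∈ SolSet, ∀ γ ∈ Λ, g⁻¹ * γ * g ∈ A1Set := by
  obtain ⟨a, b, hab⟩ := htL
  refine ⟨E 0 0 (b / (1 - exp (-t))), E_mem _ _ _, ?_⟩
  intro γ hγ
  obtain ⟨s, c, d, rfl⟩ := mem_sol (hΛSol hγ)
  have h1 := h _ _ (comm_mem hab hγ)
  have h2 : 1 - exp (-t) ≠ 0 := by
    have : exp (-t) < 1 := by simpa using ht
    linarith
  refine ⟨exp s, c, exp_pos _, ?_⟩
  rw [E_inv, E_mul, E_mul, E_val]
  congr 1
  · simp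
  · simp
  · simp
    field_simp
    linear_combination -h1

theorem conjA2 {Λ : Subgroup GL3} (hΛSol : (Λ : Set GL3) ⊆ SolSet) {t : ℝ} (ht : 0 < t)
    (htL : t ∈ L Λ) (h : ∀ p q, (p, q) ∈ S Λ → p = 0) :
    ∃ g ∈ SolSet, ∀ γ ∈ Λ, g⁻¹ * γ * g ∈ A2Set := by
  obtain ⟨a, b, hab⟩ := htL
  refine ⟨E 0 (a / (1 - exp t)) 0, E_mem _ _ _, ?_⟩
  intro γ hγ
  obtain ⟨s, c, d, rfl⟩ := mem_sol (hΛSol hγ)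
  have h1 := h _ _ (comm_mem hab hγ)
  have h2 : 1 - exp t ≠ 0 := by
    have : 1 < exp t := by simpa using ht
    linarith
  refine ⟨exp s, d, exp_pos _, ?_⟩
  rw [E_inv, E_mul, E_mul, E_val]
  congr 1
  · simp
  · simp
    field_simp
    linear_combination -h1
  · simp

/-- isolation of zero in the translation lattice -/
def Iso (H : AddSubgroup (ℝ × ℝ)) : Prop :=
  ∃ ε > 0, ∀ p q : ℝ, (p, q) ∈ H → |p| < ε → |q| < ε → p = 0 ∧ q = 0

theorem iso_of_discrete {Λ : Subgroup GL3} (h : DiscreteTopology ↥((Λ : Set GL3) ∩ TSet)) :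
    Iso (S Λ) := by
  have h1 : (1 : GL3) ∈ (Λ : Set GL3) ∩ TSet := ⟨Λ.one_mem, by rw [← E_zero, E_memT]⟩
  obtain ⟨U, hU, hU'⟩ := isOpen_induced_iff.mp (isOpen_discrete ({⟨1, h1⟩} : Set ↥((Λ : Set GL3) ∩ TSet)))
  have hc : Continuous (fun z : ℝ × ℝ => E 0 z.1 z.2) :=
    E_cont.comp (f := fun z : ℝ × ℝ => (0, z.1, z.2)) (by fun_prop)
  have hV := hU.preimage hc
  have h0 : (0 : ℝ × ℝ) ∈ (fun z : ℝ × ℝ => E 0 z.1 z.2) ⁻¹' U := by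
    have : (⟨1, h1⟩ : ↥((Λ : Set GL3) ∩ TSet)) ∈ Subtype.val ⁻¹' U := by rw [hU']; rfl
    simpa [E_zero] using this
  obtain ⟨ε, hε, hb⟩ := Metric.isOpen_iff.mp hV 0 h0
  refine ⟨ε, hε, fun p q hpq hp hq => ?_⟩
  have h2 : ((p, q) : ℝ × ℝ) ∈ Metric.ball 0 ε := by
    simp [Prod.norm_def, hp, hq]
  have h3 : E 0 p q ∈ U := hb h2
  have h4 : E 0 p q ∈ (Λ : Set GL3) ∩ TSet := ⟨hpq, by rw [E_memT]⟩
  have h5 : (⟨_, h4⟩ : ↥((Λ : Set GL3) ∩ TSet)) ∈ Subtype.val ⁻¹' U := h3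
  rw [hU'] at h5
  have h6 : E 0 p q = 1 := congrArg Subtype.val h5
  rw [← E_zero] at h6
  exact (E_inj h6).2

theorem discrete_of_iso {Λ : Subgroup GL3} (hΛSol : (Λ : Set GL3) ⊆ SolSet) (h : Iso (S Λ))
    (a b : ℝ) (ha : a ≠ 0) (hab : (a, b) ∈ S Λ) :
    DiscreteTopology ↥(Λ : Set GL3) := by
  obtain ⟨ε, hε, hiso⟩ := h
  change DiscreteTopology ↥Λ
  apply discreteTopology_of_isOpen_singleton_one
  have hent : ∀ i j : Fin 3, Continuous (fun g : GL3 => (g : Matrix (Fin 3) (Fin 3) ℝ) i j) := by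
    intro i j
    exact (Units.continuous_val).matrix_elem i j
  have hO : IsOpen {g : GL3 | |((g : Matrix (Fin 3) (Fin 3) ℝ) 0 0 - 1) * a| < ε ∧
      |((g : Matrix (Fin 3) (Fin 3) ℝ) 1 1 - 1) * b| < ε ∧
      |(g : Matrix (Fin 3) (Fin 3) ℝ) 0 2| < ε ∧ |(g : Matrix (Fin 3) (Fin 3) ℝ) 1 2| < ε} := by
    refine IsOpen.and ?_ (IsOpen.and ?_ (IsOpen.and ?_ ?_)) <;>
      refine isOpen_lt ?_ continuous_const
    · exact (((hent 0 0).sub continuous_const).mul continuous_const).abs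
    · exact (((hent 1 1).sub continuous_const).mul continuous_const).abs
    · exact (hent 0 2).abs
    · exact (hent 1 2).abs
  convert hO.preimage (continuous_subtype_val (p := fun g => g ∈ Λ)) using 1
  ext ⟨g, hg⟩
  simp only [Set.mem_singleton_iff, Set.mem_preimage, Set.mem_ofPred_eq]
  constructor
  · intro h
    have : g = 1 := congrArg Subtype.val h
    subst this
    simp [hε]
  · rintro ⟨h1, h2, h3, h4⟩
    obtain ⟨t, c, d, rfl⟩ := mem_sol (hΛSol hg)
    simp only [E_val, solMat] at h1 h2 h3 h4
    simp at h1 h2 h3 h4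
    have h5 := (S Λ).sub_mem (act ⟨c, d, hg⟩ hab) hab
    rw [Prod.mk_sub_mk] at h5
    have h6 := (hiso _ _ h5 (by
      rw [show exp t * a - a = (exp t - 1) * a by ring, abs_mul]; exact h1)
      (by
      rw [show exp (-t) * b - b = ((exp t)⁻¹ - 1) * b by rw [Real.exp_neg]; ring, abs_mul]
      exact h2)).1
    have h7 : t = 0 := by
      have : (exp t - 1) * a = 0 := by linarith
      rcases mul_eq_zero.mp this with h | h
      · have : exp t = 1 := by linarith
        simpa using this
      · exact absurd h ha
    subst h7
    obtain ⟨rfl, rfl⟩ := hiso c d hg h3 h4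
    exact Subtype.ext E_zero

theorem L_cyclic {Λ : Subgroup GL3} (h : Iso (S Λ)) (a b : ℝ) (ha : a ≠ 0)
    (hab : (a, b) ∈ S Λ) {t : ℝ} (ht : 0 < t) (htL : t ∈ L Λ) :
    ∃ g > 0, ∀ x, x ∈ L Λ ↔ ∃ n : ℤ, x = n * g := by
  obtain ⟨ε, hε, hiso⟩ := h
  have hc : ContinuousAt (fun s => max |exp s * a - a| |exp (-s) * b - b|) 0 := by fun_prop
  have hlt : ∀ᶠ s in nhds (0 : ℝ), max |exp s * a - a| |exp (-s) * b - b| < ε := by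
    apply hc.eventually_lt continuousAt_const
    simpa using hε
  obtain ⟨δ, hδ, hball⟩ := Metric.eventually_nhds_iff.mp hlt
  obtain ⟨g, hg⟩ := AddSubgroup.cyclic_of_isolated_zero (H := L Λ) hδ (by
    rw [Set.disjoint_left]
    rintro s hs ⟨h1, h2⟩
    have h3 := hball (y := s) (by rw [Real.dist_eq, sub_zero, abs_of_pos h1]; exact h2)
    have h5 := (S Λ).sub_mem (act hs hab) hab
    rw [Prod.mk_sub_mk] at h5
    have h6 := (hiso _ _ h5 ((le_max_left _ _).trans_lt h3) ((le_max_right _ _).trans_lt h3)).1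
    have : (exp s - 1) * a = 0 := by linarith
    rcases mul_eq_zero.mp this with h | h
    · have : exp s = 1 := by linarith
      have : s = 0 := by simpa using this
      linarith
    · exact absurd h ha)
  have hmem : ∀ x, x ∈ L Λ ↔ ∃ n : ℤ, x = n * g := by
    intro x
    rw [hg, AddSubgroup.mem_closure_singleton]
    simp [eq_comm]
  rcases lt_trichotomy g 0 with h | h | h
  · refine ⟨-g, by linarith, fun x => ?_⟩
    rw [hmem]
    constructor
    · rintro ⟨n, rfl⟩
      exact ⟨-n, by push_cast; ring⟩
    · rintro ⟨n, rfl⟩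
      exact ⟨-n, by push_cast; ring⟩
  · obtain ⟨n, hn⟩ := (hmem t).mp htL
    rw [h] at hn
    simp at hn
    linarith
  · exact ⟨g, h, hmem⟩

theorem psi_exists {Λ : Subgroup GL3} (hΛSol : (Λ : Set GL3) ⊆ SolSet) {g : ℝ} (hg : 0 < g)
    (hL : ∀ x, x ∈ L Λ ↔ ∃ n : ℤ, x = n * g) :
    ∃ ψ : ↥Λ →* Multiplicative ℤ, Function.Surjective ψ ∧
        ∀ x : ↥Λ, x ∈ ψ.ker ↔ (x : GL3) ∈ TSet := by
  have H : ∀ x : ↥Λ, ∃ n : ℤ, ∃ a b, (x : GL3) = E (n * g) a b := by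
    rintro ⟨x, hx⟩
    obtain ⟨t, a, b, rfl⟩ := mem_sol (hΛSol hx)
    obtain ⟨n, rfl⟩ := (hL t).mp ⟨a, b, hx⟩
    exact ⟨n, a, b, rfl⟩
  choose f hf using H
  have uniq : ∀ (x : ↥Λ) (n : ℤ) (a b : ℝ), (x : GL3) = E (n * g) a b → f x = n := by
    intro x n a b h
    obtain ⟨c, d, h'⟩ := hf x
    rw [h'] at h
    have := (E_inj h).1
    have := mul_right_cancel₀ hg.ne' this
    exact_mod_cast this
  refine ⟨MonoidHom.mk' (fun x => Multiplicative.ofAdd (f x)) ?_, ?_, ?_⟩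
  · intro x y
    obtain ⟨a, b, hx⟩ := hf x
    obtain ⟨c, d, hy⟩ := hf y
    rw [← ofAdd_add]
    congr 1
    refine uniq (x * y) (f x + f y) (exp (f x * g) * c + a) (exp (-(f x * g)) * d + b) ?_
    rw [Subgroup.coe_mul, hx, hy, E_mul]
    push_cast
    rw [add_mul]
  · intro n
    obtain ⟨a, b, h⟩ := (hL (Multiplicative.toAdd n * g)).mpr ⟨_, rfl⟩
    refine ⟨⟨_, h⟩, ?_⟩
    have := uniq ⟨_, h⟩ (Multiplicative.toAdd n) a b rfl
    simp [this]
  · intro x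
    obtain ⟨a, b, hx⟩ := hf x
    rw [MonoidHom.mem_ker, MonoidHom.mk'_apply, hx, E_memT]
    simp [hg.ne']

theorem phi_exists {Λ : Subgroup GL3} (h : Iso (S Λ)) (a b : ℝ) (ha : a ≠ 0) (hb : b ≠ 0)
    (hab : (a, b) ∈ S Λ) {t : ℝ} (ht : 0 < t) (htL : t ∈ L Λ) :
    ∃ φ : Multiplicative (ℤ × ℤ) →* GL3, Function.Injective φ ∧
        Set.range φ = (Λ : Set GL3) ∩ TSet := by
  let M : Submodule ℤ (ℝ × ℝ) := AddSubgroup.toIntSubmodule (S Λ)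
  have hM : ∀ z, z ∈ M ↔ z ∈ S Λ := fun z => Iff.rfl
  have : DiscreteTopology M := by
    obtain ⟨ε, hε, hiso⟩ := h
    change DiscreteTopology ↥(S Λ)
    apply discreteTopology_of_isOpen_singleton_zero
    have hO : IsOpen (Metric.ball (0 : ℝ × ℝ) ε) := Metric.isOpen_ball
    convert hO.preimage (continuous_subtype_val (p := fun g => g ∈ S Λ)) using 1
    ext ⟨⟨p, q⟩, hz⟩
    simp only [Set.mem_singleton_iff, Set.mem_preimage]
    constructor
    · intro h
      have : ((p, q) : ℝ × ℝ) = 0 := congrArg Subtype.val h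
      rw [this]
      simpa using hε
    · intro h
      simp [Prod.norm_def] at h
      obtain ⟨rfl, rfl⟩ := hiso p q hz h.1 h.2
      rfl
  have : IsZLattice ℝ M := by
    constructor
    rw [eq_top_iff]
    rintro ⟨x, y⟩ -
    have h1 : (a, b) ∈ Submodule.span ℝ (M : Set (ℝ × ℝ)) := Submodule.subset_span hab
    have h2 : (exp t * a, exp (-t) * b) ∈ Submodule.span ℝ (M : Set (ℝ × ℝ)) :=
      Submodule.subset_span (act htL hab)
    have e1 : exp (-t) < 1 := by simpa using ht
    have e2 : 1 < exp t := by simpa using ht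
    have e3 : exp t - exp (-t) ≠ 0 := by linarith
    have := Submodule.add_mem _
      (Submodule.smul_mem _ ((exp t * (y / b) - exp (-t) * (x / a)) / (exp t - exp (-t))) h1)
      (Submodule.smul_mem _ ((x / a - y / b) / (exp t - exp (-t))) h2)
    convert this using 1
    ext
    · simp
      field_simp
      ring
    · simp
      field_simp
      ring
  have := ZLattice.module_free ℝ M
  have := ZLattice.module_finite ℝ M
  have hr : Module.finrank ℤ M = 2 := by
    rw [ZLattice.rank ℝ M]; simp
  let e : M ≃ₗ[ℤ] (ℤ × ℤ) := LinearEquiv.ofFinrankEq _ _ (by rw [hr]; simp)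
  refine ⟨MonoidHom.mk' (fun n => E 0 (e.symm (Multiplicative.toAdd n) : ℝ × ℝ).1
    (e.symm (Multiplicative.toAdd n) : ℝ × ℝ).2) ?_, ?_, ?_⟩
  · intro x y
    simp only [toAdd_mul, map_add, Submodule.coe_add, Prod.fst_add, Prod.snd_add]
    rw [E_mul, exp_zero, neg_zero, exp_zero, one_mul, one_mul, add_zero]
    congr 1
    · exact add_comm _ _
    · exact add_comm _ _
  · intro x y hxy
    have := (E_inj hxy).2
    have h2 := e.symm.injective (Subtype.ext (Prod.ext this.1 this.2))
    exact Multiplicative.toAdd.injective h2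
  · ext g
    constructor
    · rintro ⟨n, rfl⟩
      refine ⟨(e.symm (Multiplicative.toAdd n)).2, ?_⟩
      rw [MonoidHom.mk'_apply, E_memT]
    · rintro ⟨h1, h2⟩
      obtain ⟨p, q, rfl⟩ := mem_T h2
      refine ⟨Multiplicative.ofAdd (e ⟨(p, q), h1⟩), ?_⟩
      simp

theorem cocompact {Λ : Subgroup GL3} (a b : ℝ) (ha : a ≠ 0) (hb : b ≠ 0)
    (hab : (a, b) ∈ S Λ) {t : ℝ} (ht : 0 < t) (htL : t ∈ L Λ) :
    ∃ K : Set GL3, K ⊆ SolSet ∧ IsCompact K ∧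
        ∀ g ∈ SolSet, ∃ γ ∈ Λ, ∃ k ∈ K, g = γ * k := by
  have e1 : exp (-t) < 1 := by simpa using ht
  have e2 : 1 < exp t := by simpa using ht
  have e3 : exp t - exp (-t) ≠ 0 := by linarith
  set A := |a| + |exp t * a|
  set B := |b| + |exp (-t) * b|
  refine ⟨Set.image (fun p : ℝ × ℝ × ℝ => E p.1 p.2.1 p.2.2)
    (Set.Icc 0 t ×ˢ (Set.Icc (-A) A ×ˢ Set.Icc (-B) B)), ?_, ?_, ?_⟩
  · rintro _ ⟨p, -, rfl⟩
    exact E_mem _ _ _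
  · exact (isCompact_Icc.prod (isCompact_Icc.prod isCompact_Icc)).image E_cont
  · intro g hg
    obtain ⟨s, c, d, rfl⟩ := mem_sol hg
    set n := ⌊s / t⌋ with hn
    have hn1 : n * t ≤ s := by
      have := Int.floor_le (s / t)
      rwa [le_div_iff₀ ht] at this
    have hn2 : s < (n + 1) * t := by
      have := Int.lt_floor_add_one (s / t)
      rwa [div_lt_iff₀ ht] at this
    have hnL : (n : ℝ) * t ∈ L Λ := by simpa using (L Λ).zsmul_mem htL n
    obtain ⟨u, v, huv⟩ := hnL
    obtain ⟨s', x, y, hxy⟩ : ∃ s' x y, (E (n * t) u v)⁻¹ * E s c d = E s' x y ∧ s' = s - n * t := by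
      refine ⟨_, _, _, by rw [E_inv, E_mul], by ring⟩
    obtain ⟨hxy, hs'⟩ := hxy
    set α := (exp t * (y / b) - exp (-t) * (x / a)) / (exp t - exp (-t)) with hα
    set β := (x / a - y / b) / (exp t - exp (-t)) with hβ
    have hx : x = α * a + β * (exp t * a) := by rw [hα, hβ]; field_simp; ring
    have hy : y = α * b + β * (exp (-t) * b) := by rw [hα, hβ]; field_simp; ring
    have hw := (S Λ).add_mem ((S Λ).zsmul_mem hab ⌊α⌋) ((S Λ).zsmul_mem (act htL hab) ⌊β⌋)
    simp only [Prod.smul_mk, zsmul_eq_mul, Prod.mk_add_mk] at hw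
    have fr : ∀ z : ℝ, |Int.fract z| ≤ 1 := fun z => by
      rw [abs_of_nonneg (Int.fract_nonneg z)]; exact (Int.fract_lt_one z).le
    have bd : ∀ p q : ℝ, |Int.fract α * p + Int.fract β * q| ≤ |p| + |q| := by
      intro p q
      refine (abs_add_le _ _).trans ?_
      rw [abs_mul, abs_mul]
      have := mul_le_mul_of_nonneg_right (fr α) (abs_nonneg p)
      have := mul_le_mul_of_nonneg_right (fr β) (abs_nonneg q)
      linarith
    refine ⟨_, Λ.mul_mem huv hw, _, ⟨(s', Int.fract α * a + Int.fract β * (exp t * a),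
      Int.fract α * b + Int.fract β * (exp (-t) * b)), ⟨⟨?_, ?_⟩, ?_, ?_⟩, rfl⟩, ?_⟩
    · simp only; linarith
    · simp only; linarith
    · exact abs_le.mp (bd _ _)
    · exact abs_le.mp (bd _ _)
    · rw [mul_assoc, eq_comm, ← eq_inv_mul_iff_mul_eq, hxy, E_mul]
      congr 1
      · ring
      · rw [hx]; simp only [Int.fract, exp_zero, neg_zero, one_mul]; ring
      · rw [hy]; simp only [Int.fract, exp_zero, neg_zero, one_mul]; ring

end SolAux

/-- Let `Λ` be a non-abelian subgroup of `Sol`, and `Λ₀ := Λ ∩ T`.  Then either `Λ₀` is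
discrete, in which case `Λ` is a discrete cocompact subgroup of `Sol` with `Λ₀ ≅ ℤ²` and
`Λ/Λ₀ ≅ ℤ`; or `Λ₀` is non-discrete, and then either `Λ₀` is dense in `T` or `Λ` is
contained in a `Sol`-conjugate of `A₁` or of `A₂`. -/
theorem sol_subgroup_dichotomy
    (Λ : Subgroup GL3) (hΛSol : (Λ : Set GL3) ⊆ SolSet)
    (hnonab : ∃ x ∈ Λ, ∃ y ∈ Λ, x * y ≠ y * x) :
    (DiscreteTopology ↥((Λ : Set GL3) ∩ TSet) ∧
      DiscreteTopology ↥(Λ : Set GL3) ∧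
      (∃ K : Set GL3, K ⊆ SolSet ∧ IsCompact K ∧
        ∀ g ∈ SolSet, ∃ γ ∈ Λ, ∃ k ∈ K, g = γ * k) ∧
      (∃ φ : Multiplicative (ℤ × ℤ) →* GL3, Function.Injective φ ∧
        Set.range φ = (Λ : Set GL3) ∩ TSet) ∧
      (∃ ψ : ↥Λ →* Multiplicative ℤ, Function.Surjective ψ ∧
        ∀ x : ↥Λ, x ∈ ψ.ker ↔ (x : GL3) ∈ TSet))
    ∨
    (¬ DiscreteTopology ↥((Λ : Set GL3) ∩ TSet) ∧
      (TSet ⊆ closure ((Λ : Set GL3) ∩ TSet) ∨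
        ∃ g ∈ SolSet,
          (∀ γ ∈ Λ, g⁻¹ * γ * g ∈ A1Set) ∨ (∀ γ ∈ Λ, g⁻¹ * γ * g ∈ A2Set))) := by
  obtain ⟨x, hx, y, hy, hxy⟩ := hnonab
  obtain ⟨s, a, b, rfl⟩ := SolAux.mem_sol (hΛSol hx)
  obtain ⟨s', c, d, rfl⟩ := SolAux.mem_sol (hΛSol hy)
  have hcomm := SolAux.comm_mem hx hy
  obtain ⟨t, ht, htL⟩ : ∃ t > 0, t ∈ SolAux.L Λ := by
    have hs : s ∈ SolAux.L Λ := ⟨_, _, hx⟩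
    have hs' : s' ∈ SolAux.L Λ := ⟨_, _, hy⟩
    have key : ∀ r ∈ SolAux.L Λ, r ≠ 0 → ∃ t > 0, t ∈ SolAux.L Λ := by
      intro r hr h
      rcases lt_or_gt_of_ne h with h | h
      · exact ⟨-r, by linarith, neg_mem hr⟩
      · exact ⟨r, h, hr⟩
    by_cases h : s = 0
    · by_cases h' : s' = 0
      · subst h h'
        exact absurd (by rw [SolAux.E_mul, SolAux.E_mul]; simp [add_comm]) hxy
      · exact key _ hs' h'
    · exact key _ hs h
  obtain ⟨p₀, q₀, hpq, hpq0⟩ : ∃ p q, (p, q) ∈ SolAux.S Λ ∧ ¬ (p = 0 ∧ q = 0) := by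
    refine ⟨_, _, hcomm, fun h => hxy ?_⟩
    rw [SolAux.E_mul, SolAux.E_mul, add_comm s s', sub_eq_zero.mp h.1, sub_eq_zero.mp h.2]
  have hi := SolAux.inv_S htL
  have hab : (∀ p q, (p, q) ∈ SolAux.S Λ → q = 0) ∨ (∀ p q, (p, q) ∈ SolAux.S Λ → p = 0) ∨
      ∃ p q, (p, q) ∈ SolAux.S Λ ∧ p ≠ 0 ∧ q ≠ 0 := by
    by_contra! h
    obtain ⟨⟨p, q, h1, hq⟩, ⟨p', q', h2, hp'⟩, h3⟩ := h
    have hp : p = 0 := by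
      by_contra h
      exact hq (h3 p q h1 h)
    have hq' := h3 p' q' h2 hp'
    subst hp hq'
    have := (SolAux.S Λ).add_mem h1 h2
    rw [Prod.mk_add_mk] at this
    exact hq (by simpa using h3 _ _ this (by simpa using hp'))
  by_cases hd : DiscreteTopology ↥((Λ : Set GL3) ∩ TSet)
  · left
    have hiso := SolAux.iso_of_discrete hd
    rcases hab with h | h | ⟨p, q, h, hp, hq⟩
    · exfalso
      have := h _ _ hpq
      subst this
      obtain ⟨ε, hε, hiso⟩ := hiso
      obtain ⟨p, q, h1, h2, h3, h4⟩ := SolAux.smallX ht _ hi p₀ (by simpa using hpq0) hpq ε hε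
      exact h4 (hiso p q h1 h2 h3).1
    · exfalso
      have := h _ _ hpq
      subst this
      obtain ⟨ε, hε, hiso⟩ := hiso
      obtain ⟨p, q, h1, h2, h3, h4⟩ := SolAux.smallY ht _ hi q₀ (by simpa using hpq0) hpq ε hε
      exact h4 (hiso p q h1 h2 h3).2
    · obtain ⟨g, hg, hL⟩ := SolAux.L_cyclic hiso p q hp h ht htL
      exact ⟨hd, SolAux.discrete_of_iso hΛSol hiso p q hp h,
        SolAux.cocompact p q hp hq h ht htL,
        SolAux.phi_exists hiso p q hp hq h ht htL, SolAux.psi_exists hΛSol hg hL⟩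
  · right
    refine ⟨hd, ?_⟩
    rcases hab with h | h | ⟨p, q, h, hp, hq⟩
    · obtain ⟨g, hg, h⟩ := SolAux.conjA1 hΛSol ht htL h
      exact Or.inr ⟨g, hg, Or.inl h⟩
    · obtain ⟨g, hg, h⟩ := SolAux.conjA2 hΛSol ht htL h
      exact Or.inr ⟨g, hg, Or.inr h⟩
    · left
      have hniso : ¬ SolAux.Iso (SolAux.S Λ) := by
        intro hiso
        have := SolAux.discrete_of_iso hΛSol hiso p q hp h
        exact hd (DiscreteTopology.of_subset this Set.inter_subset_left)
      have hs : ∀ ε > 0, ∃ p q : ℝ, (p, q) ∈ (SolAux.S Λ).topologicalClosure ∧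
          |p| < ε ∧ |q| < ε ∧ (p, q) ≠ 0 := by
        intro ε hε
        by_contra! hcon
        apply hniso
        refine ⟨ε, hε, fun p q h1 h2 h3 => ?_⟩
        have := hcon p q ((SolAux.S Λ).le_topologicalClosure h1) h2 h3
        simpa using this
      intro g hg
      obtain ⟨x, y, rfl⟩ := SolAux.mem_T hg
      have hmem := SolAux.dense_all ht _ (SolAux.S Λ).isClosed_topologicalClosure
        (SolAux.inv_closure hi) p q hp hq ((SolAux.S Λ).le_topologicalClosure h) hs (x, y)
      have hc : Continuous (fun z : ℝ × ℝ => SolAux.E 0 z.1 z.2) :=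
        SolAux.E_cont.comp (f := fun z : ℝ × ℝ => (0, z.1, z.2)) (by fun_prop)
      exact map_mem_closure (f := fun z : ℝ × ℝ => SolAux.E 0 z.1 z.2) hc hmem (fun z hz => ⟨hz, by rw [SolAux.E_memT]⟩)
end
end

section
/- Under the stated hypotheses: [𝔞⁻,𝔞⁻] = 0, [L,𝔞⁻] = 𝔞⁺ (and 𝔞⁺ = 𝔤⁺), [𝔞⁻,𝔞⁺] ⊆ ℝ·V, and [𝔞⁺,𝔞⁺] = 0; consequently the bracket of any two elements of 𝔞 lies in ℝ·V, i.e., [V^⊥, V^⊥] ⊆ ℝ·V where V^⊥ = ℝ·V ⊕ 𝔞. -/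
noncomputable section

variable {𝔤 : Type*} [LieRing 𝔤] [LieAlgebra ℝ 𝔤]

/-- The `+1`-eigenspace `𝔤⁺` of an involution `Θ`. -/
def plusSpace (Θ : 𝔤 →ₗ⁅ℝ⁆ 𝔤) : Submodule ℝ 𝔤 :=
  LinearMap.ker (Θ.toLinearMap - LinearMap.id)

/-- The `−1`-eigenspace `𝔤⁻` of an involution `Θ`. -/
def minusSpace (Θ : 𝔤 →ₗ⁅ℝ⁆ 𝔤) : Submodule ℝ 𝔤 :=
  LinearMap.ker (Θ.toLinearMap + LinearMap.id)

/-- `𝔞`, the `B`-orthogonal complement of `span{L, V}`. -/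
def aSpace (B : LinearMap.BilinForm ℝ 𝔤) (L V : 𝔤) : Submodule ℝ 𝔤 :=
  LinearMap.ker (B.flip L) ⊓ LinearMap.ker (B.flip V)

/-- Under the transvection-algebra hypotheses (invariant nondegenerate symmetric `B`,
involution `Θ` preserving `B`, `[𝔤⁻,𝔤⁻] = 𝔤⁺`, isotropic `L, V ∈ 𝔤⁻` with `B(L,V) = 1`,
`V` central, and flatness `[[𝔞⁻,𝔞⁻],𝔞⁻] = 0`) one has: `[𝔞⁻,𝔞⁻] = 0`, `[L,𝔞⁻] = 𝔞⁺`
(and `𝔞⁺ = 𝔤⁺`), `[𝔞⁻,𝔞⁺] ⊆ ℝ·V`, `[𝔞⁺,𝔞⁺] = 0`; consequently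
`[V^⊥, V^⊥] ⊆ ℝ·V` where `V^⊥ = ℝ·V ⊕ 𝔞`. -/
theorem transvection_derived_subalgebra
    [Module.Finite ℝ 𝔤]
    (B : LinearMap.BilinForm ℝ 𝔤)
    (hBsymm : ∀ x y : 𝔤, B x y = B y x)
    (hBnd : B.Nondegenerate)
    (hBinv : ∀ x y z : 𝔤, B ⁅x, y⁆ z + B y ⁅x, z⁆ = 0)
    (Θ : 𝔤 →ₗ⁅ℝ⁆ 𝔤)
    (hΘinv : Function.Involutive Θ)
    (hΘB : ∀ x y : 𝔤, B (Θ x) (Θ y) = B x y)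
    (htrans : Submodule.span ℝ
        {z : 𝔤 | ∃ x ∈ minusSpace Θ, ∃ y ∈ minusSpace Θ, z = ⁅x, y⁆} = plusSpace Θ)
    (L V : 𝔤)
    (hL : L ∈ minusSpace Θ) (hV : V ∈ minusSpace Θ)
    (hLL : B L L = 0) (hVV : B V V = 0) (hLV : B L V = 1)
    (hVcentral : ∀ x : 𝔤, ⁅V, x⁆ = 0)
    (hflat : ∀ x ∈ aSpace B L V ⊓ minusSpace Θ, ∀ y ∈ aSpace B L V ⊓ minusSpace Θ,
        ∀ z ∈ aSpace B L V ⊓ minusSpace Θ, ⁅⁅x, y⁆, z⁆ = 0) :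
    (∀ x ∈ aSpace B L V ⊓ minusSpace Θ, ∀ y ∈ aSpace B L V ⊓ minusSpace Θ,
        ⁅x, y⁆ = 0) ∧
    Submodule.map (LieAlgebra.ad ℝ 𝔤 L) (aSpace B L V ⊓ minusSpace Θ)
      = aSpace B L V ⊓ plusSpace Θ ∧
    aSpace B L V ⊓ plusSpace Θ = plusSpace Θ ∧
    (∀ x ∈ aSpace B L V ⊓ minusSpace Θ, ∀ y ∈ aSpace B L V ⊓ plusSpace Θ,
        ⁅x, y⁆ ∈ Submodule.span ℝ {V}) ∧
    (∀ x ∈ aSpace B L V ⊓ plusSpace Θ, ∀ y ∈ aSpace B L V ⊓ plusSpace Θ,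
        ⁅x, y⁆ = 0) ∧
    (∀ x ∈ Submodule.span ℝ {V} ⊔ aSpace B L V,
      ∀ y ∈ Submodule.span ℝ {V} ⊔ aSpace B L V,
        ⁅x, y⁆ ∈ Submodule.span ℝ {V}) := by
  have nd : ∀ x : 𝔤, (∀ y, B x y = 0) → x = 0 := fun x hx => hBnd.1 x hx
  have memP : ∀ x, x ∈ plusSpace Θ ↔ Θ x = x := fun x => by
    simp [plusSpace, sub_eq_zero]
  have memM : ∀ x, x ∈ minusSpace Θ ↔ Θ x = -x := fun x => by
    simp [minusSpace, add_eq_zero_iff_eq_neg]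
  have memA : ∀ x, x ∈ aSpace B L V ↔ B x L = 0 ∧ B x V = 0 := fun x => by
    simp [aSpace]
  have hVc' : ∀ x : 𝔤, ⁅x, V⁆ = 0 := fun x => by rw [← lie_skew, hVcentral, neg_zero]
  have hVL : B V L = 1 := by rw [hBsymm, hLV]
  have inv : ∀ x y z : 𝔤, B ⁅x, y⁆ z = - B y ⁅x, z⁆ := fun x y z => by
    linarith [hBinv x y z]
  have orth : ∀ x ∈ plusSpace Θ, ∀ y ∈ minusSpace Θ, B x y = 0 := by
    intro x hx y hy
    have h := hΘB x y
    rw [(memP x).1 hx, (memM y).1 hy, map_neg] at h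
    linarith
  have pA : ∀ x ∈ plusSpace Θ, x ∈ aSpace B L V := fun x hx =>
    (memA x).2 ⟨orth x hx L hL, orth x hx V hV⟩
  have MM : ∀ x ∈ minusSpace Θ, ∀ y ∈ minusSpace Θ, ⁅x, y⁆ ∈ plusSpace Θ := by
    intro x hx y hy
    rw [memP, LieHom.map_lie, (memM x).1 hx, (memM y).1 hy, neg_lie, lie_neg, neg_neg]
  have MP : ∀ x ∈ minusSpace Θ, ∀ y ∈ plusSpace Θ, ⁅x, y⁆ ∈ minusSpace Θ := by
    intro x hx y hy
    rw [memM, LieHom.map_lie, (memM x).1 hx, (memP y).1 hy, neg_lie]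
  have decM : ∀ x ∈ minusSpace Θ, ∃ a b : ℝ, ∃ w ∈ aSpace B L V ⊓ minusSpace Θ,
      x = a • L + b • V + w := by
    intro x hx
    refine ⟨B x V, B x L, x - (B x V • L + B x L • V), ⟨(memA _).2 ⟨?_, ?_⟩, ?_⟩, ?_⟩
    · simp [hLL, hVL]
    · simp [hLV, hVV]
    · exact Submodule.sub_mem _ hx (Submodule.add_mem _ (Submodule.smul_mem _ _ hL)
        (Submodule.smul_mem _ _ hV))
    · abel
  have dec : ∀ x : 𝔤, ∃ p ∈ plusSpace Θ, ∃ m ∈ minusSpace Θ, x = p + m := by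
    intro x
    refine ⟨(1/2 : ℝ) • (x + Θ x), (memP _).2 ?_, (1/2 : ℝ) • (x - Θ x), (memM _).2 ?_, ?_⟩
    · rw [map_smul, map_add, hΘinv x, add_comm]
    · rw [map_smul, map_sub, hΘinv x, ← smul_neg, neg_sub]
    · module
  have h1 : ∀ x ∈ aSpace B L V ⊓ minusSpace Θ, ∀ y ∈ aSpace B L V ⊓ minusSpace Θ,
      ⁅x, y⁆ = 0 := by
    intro x hx y hy
    have hP := MM x hx.2 y hy.2
    have key : ∀ u : 𝔤, ∀ z ∈ aSpace B L V ⊓ minusSpace Θ, B ⁅x, y⁆ ⁅u, z⁆ = 0 := by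
      intro u z hz
      have e : ⁅⁅x, y⁆, z⁆ = 0 := hflat x hx y hy z hz
      have e1 := inv z ⁅x, y⁆ u
      rw [← lie_skew z, e, neg_zero, map_zero, LinearMap.zero_apply, ← lie_skew z u, map_neg] at e1
      linarith
    have key2 : ∀ u ∈ plusSpace Θ, B ⁅x, y⁆ u = 0 := by
      intro u hu
      rw [← htrans] at hu
      induction hu using Submodule.span_induction with
      | mem u hu =>
        obtain ⟨s, hs, t, ht, rfl⟩ := hu
        obtain ⟨a, b, w, hw, rfl⟩ := decM s hs
        obtain ⟨c, d, w', hw', rfl⟩ := decM t ht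
        have k1 := key L w' hw'
        have k2 := key w w' hw'
        have k3 := key L w hw
        have k4 : B ⁅x, y⁆ ⁅w, L⁆ = 0 := by rw [← lie_skew w, map_neg, k3, neg_zero]
        simp [hVcentral, hVc', k1, k2, k4]
      | zero => simp
      | add u v _ _ hu hv => rw [map_add, hu, hv, add_zero]
      | smul a u _ hu => rw [map_smul, hu, smul_zero]
    apply nd
    intro z
    obtain ⟨p, hp, m, hm, rfl⟩ := dec z
    rw [map_add, key2 p hp, orth _ hP m hm, add_zero]
  have LM : ∀ u ∈ plusSpace Θ, ⁅L, u⁆ ∈ aSpace B L V ⊓ minusSpace Θ := by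
    intro u hu
    refine ⟨(memA _).2 ⟨?_, ?_⟩, MP L hL u hu⟩
    · rw [inv, lie_self, map_zero, neg_zero]
    · rw [inv, hVc', map_zero, neg_zero]
  have h3 : aSpace B L V ⊓ plusSpace Θ = plusSpace Θ := inf_eq_right.2 pA
  have h2 : Submodule.map (LieAlgebra.ad ℝ 𝔤 L : 𝔤 →ₗ[ℝ] 𝔤) (aSpace B L V ⊓ minusSpace Θ)
      = aSpace B L V ⊓ plusSpace Θ := by
    rw [h3]
    apply le_antisymm
    · rintro _ ⟨w, hw, rfl⟩
      exact MM L hL w hw.2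
    · rw [← htrans, Submodule.span_le]
      rintro _ ⟨s, hs, t, ht, rfl⟩
      obtain ⟨a, b, w, hw, rfl⟩ := decM s hs
      obtain ⟨c, d, w', hw', rfl⟩ := decM t ht
      refine ⟨a • w' - c • w, Submodule.sub_mem _ (Submodule.smul_mem _ _ hw')
        (Submodule.smul_mem _ _ hw), ?_⟩
      have k : ⁅w, L⁆ = -⁅L, w⁆ := (lie_skew _ _).symm
      simp [hVcentral, hVc', h1 w hw w' hw']
      rw [k]
      module
  have h4 : ∀ x ∈ aSpace B L V ⊓ minusSpace Θ, ∀ y ∈ aSpace B L V ⊓ plusSpace Θ,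
        ⁅x, y⁆ ∈ Submodule.span ℝ {V} := by
    intro x hx y hy
    rw [Submodule.mem_span_singleton]
    refine ⟨B ⁅x, y⁆ L, ?_⟩
    rw [eq_comm, ← sub_eq_zero]
    apply nd
    intro z
    obtain ⟨p, hp, m, hm, rfl⟩ := dec z
    obtain ⟨a, b, w, hw, rfl⟩ := decM m hm
    have e1 : B ⁅x, y⁆ p = 0 := by rw [hBsymm]; exact orth p hp _ (MP x hx.2 y hy.2)
    have e2 : B V p = 0 := by rw [hBsymm]; exact orth p hp _ hV
    have e3 : B ⁅x, y⁆ w = 0 := by rw [inv, h1 x hx w hw, map_zero, neg_zero]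
    have e4 : B V w = 0 := by rw [hBsymm]; exact ((memA w).1 hw.1).2
    have e5 : B ⁅x, y⁆ V = 0 := by rw [inv, hVc', map_zero, neg_zero]
    simp [e1, e2, e3, e4, e5, hVV, hVL]
    ring
  have h5 : ∀ x ∈ aSpace B L V ⊓ plusSpace Θ, ∀ y ∈ aSpace B L V ⊓ plusSpace Θ,
        ⁅x, y⁆ = 0 := by
    intro x hx y hy
    have hy' := hy
    rw [← h2] at hy'
    obtain ⟨w, hw, rfl⟩ := hy'
    change ⁅x, ⁅L, w⁆⁆ = 0
    obtain ⟨c, hc⟩ := Submodule.mem_span_singleton.1 (h4 w hw x hx)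
    have e : ⁅x, w⁆ = -(c • V) := by rw [hc, lie_skew]
    rw [leibniz_lie, e, ← lie_skew x L, neg_lie, h1 _ (LM x hx.2) w hw]
    simp [hVc']
  refine ⟨h1, h2, h3, h4, h5, ?_⟩
  have decA : ∀ x ∈ Submodule.span ℝ {V} ⊔ aSpace B L V, ∃ c : ℝ,
      ∃ p ∈ aSpace B L V ⊓ plusSpace Θ, ∃ m ∈ aSpace B L V ⊓ minusSpace Θ,
      x = c • V + (p + m) := by
    intro x hx
    obtain ⟨v, hv, a, ha, rfl⟩ := Submodule.mem_sup.1 hx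
    obtain ⟨c, rfl⟩ := Submodule.mem_span_singleton.1 hv
    obtain ⟨p, hp, m, hm, rfl⟩ := dec a
    refine ⟨c, p, ⟨pA p hp, hp⟩, m, ⟨?_, hm⟩, rfl⟩
    have := Submodule.sub_mem _ ha (pA p hp)
    rwa [add_sub_cancel_left] at this
  intro x hx y hy
  obtain ⟨c, p, hp, m, hm, rfl⟩ := decA x hx
  obtain ⟨d, q, hq, n, hn, rfl⟩ := decA y hy
  have e : ⁅c • V + (p + m), d • V + (q + n)⁆ = -⁅n, p⁆ + ⁅m, q⁆ := by
    rw [lie_skew]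
    simp [hVcentral, hVc', h1 m hm n hn, h5 p hp q hq]
    try abel
  rw [e]
  exact Submodule.add_mem _ (Submodule.neg_mem _ (h4 n hn p hp)) (h4 m hm q hq)
end
end

section
/- Under the stated hypotheses, for all A₁, A₂ ∈ 𝔞 one has [A₁, A₂] = B([L,A₁], A₂) · V; in other words, the Lie bracket on 𝔞 is given by the 2-form ω(A₁,A₂) := B([L,A₁],A₂) with values in the central direction V. -/
noncomputable section

variable {𝔤 : Type*} [LieRing 𝔤] [LieAlgebra ℝ 𝔤]

/-- Under the transvection-algebra hypotheses (invariant nondegenerate symmetric `B`,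
involution `Θ` preserving `B`, `[𝔤⁻,𝔤⁻] = 𝔤⁺`, isotropic `L, V ∈ 𝔤⁻` with `B(L,V) = 1`,
`V` central, and flatness `[[𝔞⁻,𝔞⁻],𝔞⁻] = 0`), for all `A₁, A₂ ∈ 𝔞` one has
`[A₁,A₂] = B([L,A₁],A₂) · V`: the Lie bracket on `𝔞` is given by the `2`-form
`ω(A₁,A₂) := B([L,A₁],A₂)` with values in the central direction `V`. -/
theorem transvection_bracket_eq_omega_smul
    [Module.Finite ℝ 𝔤]
    (B : LinearMap.BilinForm ℝ 𝔤)
    (hBsymm : ∀ x y : 𝔤, B x y = B y x)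
    (hBnd : B.Nondegenerate)
    (hBinv : ∀ x y z : 𝔤, B ⁅x, y⁆ z + B y ⁅x, z⁆ = 0)
    (Θ : 𝔤 →ₗ⁅ℝ⁆ 𝔤)
    (hΘinv : Function.Involutive Θ)
    (hΘB : ∀ x y : 𝔤, B (Θ x) (Θ y) = B x y)
    (htrans : Submodule.span ℝ
        {z : 𝔤 | ∃ x ∈ minusSpace Θ, ∃ y ∈ minusSpace Θ, z = ⁅x, y⁆} = plusSpace Θ)
    (L V : 𝔤)
    (hL : L ∈ minusSpace Θ) (hV : V ∈ minusSpace Θ)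
    (hLL : B L L = 0) (hVV : B V V = 0) (hLV : B L V = 1)
    (hVcentral : ∀ x : 𝔤, ⁅V, x⁆ = 0)
    (hflat : ∀ x ∈ aSpace B L V ⊓ minusSpace Θ, ∀ y ∈ aSpace B L V ⊓ minusSpace Θ,
        ∀ z ∈ aSpace B L V ⊓ minusSpace Θ, ⁅⁅x, y⁆, z⁆ = 0) :
    ∀ A₁ ∈ aSpace B L V, ∀ A₂ ∈ aSpace B L V,
      ⁅A₁, A₂⁆ = (B ⁅L, A₁⁆ A₂) • V := by
  have ma : ∀ A, A ∈ aSpace B L V ↔ B A L = 0 ∧ B A V = 0 := by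
    intro A; simp [aSpace]
  have mm : ∀ x, x ∈ minusSpace Θ ↔ Θ x = -x := by
    intro x; simp [minusSpace, add_eq_zero_iff_eq_neg]
  have mp : ∀ x, x ∈ plusSpace Θ ↔ Θ x = x := by
    intro x; simp [plusSpace, sub_eq_zero]
  have hΘL := (mm L).1 hL
  have hΘV := (mm V).1 hV
  have hVL : B V L = 1 := by rw [hBsymm]; exact hLV
  have hcV : ∀ x : 𝔤, ⁅x, V⁆ = 0 := by
    intro x; rw [← lie_skew, hVcentral, neg_zero]
  have ortho : ∀ p x, Θ p = p → Θ x = -x → B p x = 0 := by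
    intro p x h1 h2
    have := hΘB p x
    rw [h1, h2, map_neg] at this; linarith
  have ext0 : ∀ z, (∀ w, Θ w = w → B z w = 0) → (∀ w, Θ w = -w → B z w = 0) → z = 0 := by
    intro z h1 h2
    apply hBnd.1 z
    intro w
    have e : w = (1/2 : ℝ) • (w + Θ w) + (1/2 : ℝ) • (w - Θ w) := by module
    have a1 := h1 (w + Θ w) (by rw [map_add, hΘinv w]; abel)
    have a2 := h2 (w - Θ w) (by rw [map_sub, hΘinv w]; abel)
    rw [e, map_add, map_smul, map_smul, a1, a2]; simp
  have dec : ∀ u, Θ u = -u → ∃ u' a b, (u' ∈ aSpace B L V ⊓ minusSpace Θ) ∧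
      u = u' + (a : ℝ) • L + (b : ℝ) • V := by
    intro u hu
    refine ⟨u - B u V • L - B u L • V, B u V, B u L, ⟨(ma _).2 ⟨?_, ?_⟩, (mm _).2 ?_⟩, by module⟩
    · simp [hLL, hVL]
    · simp [hVV, hLV]
    · simp only [map_sub, map_smul, hu, hΘL, hΘV]; module
  have step1 : ∀ x ∈ aSpace B L V ⊓ minusSpace Θ, ∀ y ∈ aSpace B L V ⊓ minusSpace Θ,
      ⁅x, y⁆ = 0 := by
    intro x hx y hy
    have hx2 := (mm x).1 hx.2
    have hy2 := (mm y).1 hy.2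
    have hT : Θ ⁅x, y⁆ = ⁅x, y⁆ := by rw [LieHom.map_lie, hx2, hy2]; simp
    apply ext0
    · intro w hw
      have hw' := (mp w).2 hw
      rw [← htrans] at hw'
      induction hw' using Submodule.span_induction with
      | mem w h =>
        obtain ⟨u, hu, v, hv, rfl⟩ := h
        obtain ⟨u', a, b, hu', rfl⟩ := dec u ((mm u).1 hu)
        obtain ⟨v', c, d, hv', rfl⟩ := dec v ((mm v).1 hv)
        have f1 := hflat x hx y hy u' hu'
        have f2 := hflat x hx y hy v' hv'
        generalize ⁅x, y⁆ = N at *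
        have g1 := hBinv N L v'
        have g2 := hBinv N L L
        have g3 := hBinv N L u'
        have k1 := hBinv u' N v'
        have k2 := hBinv u' N L
        have k3 := hBinv L N v'
        have s1 : ⁅u', N⁆ = 0 := by rw [← lie_skew, f1, neg_zero]
        have s2 : ⁅L, N⁆ = -⁅N, L⁆ := (lie_skew _ _).symm
        rw [s1] at k1 k2
        rw [s2] at k3
        rw [f2] at g1
        simp only [map_zero, map_neg, LinearMap.neg_apply, LinearMap.zero_apply] at g1 k1 k2 k3
        simp only [lie_add, add_lie, lie_smul, smul_lie, hcV, hVcentral, lie_self, map_add,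
          map_smul, smul_zero, map_zero, smul_eq_mul]
        have e1 : B N ⁅u', v'⁆ = 0 := by linarith
        have e2 : B N ⁅u', L⁆ = 0 := by linarith
        have e3 : B N ⁅L, v'⁆ = 0 := by linarith
        rw [e1, e2, e3]; ring
      | zero => simp
      | add u v hu hv h1 h2 =>
        rw [htrans] at hu hv
        rw [map_add, h1 ((mp _).1 hu), h2 ((mp _).1 hv), add_zero]
      | smul a u hu h1 =>
        rw [htrans] at hu
        rw [map_smul, h1 ((mp _).1 hu), smul_zero]
    · intro w hw
      exact ortho _ _ hT hw
  have step2 : ∀ w, Θ w = w → ∃ x ∈ aSpace B L V ⊓ minusSpace Θ, w = ⁅L, x⁆ := by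
    intro w hw
    have hw' := (mp w).2 hw
    rw [← htrans] at hw'
    clear hw
    induction hw' using Submodule.span_induction with
    | mem w h =>
      obtain ⟨u, hu, v, hv, rfl⟩ := h
      obtain ⟨u', a, b, hu', rfl⟩ := dec u ((mm u).1 hu)
      obtain ⟨v', c, d, hv', rfl⟩ := dec v ((mm v).1 hv)
      refine ⟨a • v' - c • u', Submodule.sub_mem _ (Submodule.smul_mem _ _ hv')
        (Submodule.smul_mem _ _ hu'), ?_⟩
      simp only [lie_add, add_lie, lie_smul, smul_lie, hcV, hVcentral, lie_self, lie_sub,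
          smul_zero, step1 u' hu' v' hv']
      rw [← lie_skew u' L]; module
    | zero => exact ⟨0, Submodule.zero_mem _, by simp⟩
    | add u v hu hv h1 h2 =>
      obtain ⟨x, hx, rfl⟩ := h1
      obtain ⟨y, hy, rfl⟩ := h2
      exact ⟨x + y, Submodule.add_mem _ hx hy, by simp⟩
    | smul a u hu h1 =>
      obtain ⟨x, hx, rfl⟩ := h1
      exact ⟨a • x, Submodule.smul_mem _ _ hx, by simp⟩
  have step3 : ∀ x ∈ aSpace B L V ⊓ minusSpace Θ, ∀ p, Θ p = p →
      ⁅x, p⁆ = (B ⁅L, x⁆ p) • V := by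
    intro x hx p hp
    have hx2 := (mm x).1 hx.2
    have hT : Θ (⁅x, p⁆ - (B ⁅L, x⁆ p) • V) = -(⁅x, p⁆ - (B ⁅L, x⁆ p) • V) := by
      rw [map_sub, LieHom.map_lie, map_smul, hx2, hp, hΘV, neg_lie]; module
    rw [← sub_eq_zero]
    apply ext0
    · intro w hw
      rw [hBsymm]; exact ortho _ _ hw hT
    · intro w hw
      obtain ⟨u', a, b, hu', rfl⟩ := dec w hw
      have k1 := hBinv x p u'
      rw [step1 x hx u' hu', map_zero] at k1
      have k2 := hBinv x p L
      have k3 := hBinv x p V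
      rw [hcV, map_zero] at k3
      rw [← lie_skew x L, map_neg, hBsymm p] at k2
      have k4 := ((ma _).1 hu'.1).2
      rw [hBsymm] at k4
      simp only [map_add, map_sub, map_smul, LinearMap.sub_apply, LinearMap.smul_apply, smul_eq_mul,
        k4, hVL, hVV]
      have e1 : B ⁅x, p⁆ u' = 0 := by linarith
      have e2 : B ⁅x, p⁆ V = 0 := by linarith
      have e3 : B ⁅x, p⁆ L = B ⁅L, x⁆ p := by linarith
      rw [e1, e2, e3]; ring
  have stab : ∀ q, Θ q = q → ⁅L, q⁆ ∈ aSpace B L V ⊓ minusSpace Θ := by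
    intro q hq
    refine ⟨(ma _).2 ⟨?_, ?_⟩, (mm _).2 ?_⟩
    · have := hBinv L q L
      rwa [lie_self, map_zero, add_zero] at this
    · have := hBinv L q V
      rwa [hcV, map_zero, add_zero] at this
    · rw [LieHom.map_lie, hΘL, hq, neg_lie]
  have step4 : ∀ p q, Θ p = p → Θ q = q → ⁅p, q⁆ = 0 := by
    intro p q hp hq
    obtain ⟨x, hx, rfl⟩ := step2 p hp
    rw [lie_lie, step3 x hx q hq, lie_smul, hcV, smul_zero, step1 x hx _ (stab q hq), sub_zero]
  have split : ∀ A ∈ aSpace B L V, ∃ p x, Θ p = p ∧ x ∈ aSpace B L V ⊓ minusSpace Θ ∧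
      A = p + x := by
    intro A hA
    obtain ⟨h1, h2⟩ := (ma A).1 hA
    have h3 := hΘB A L
    have h4 := hΘB A V
    rw [hΘL, map_neg] at h3
    rw [hΘV, map_neg] at h4
    refine ⟨(1/2 : ℝ) • (A + Θ A), (1/2 : ℝ) • (A - Θ A), ?_, ⟨(ma _).2 ⟨?_, ?_⟩, (mm _).2 ?_⟩,
      by module⟩
    · rw [map_smul, map_add, hΘinv A, add_comm]
    · simp; linarith
    · simp; linarith
    · rw [map_smul, map_sub, hΘinv A]; module
  intro A₁ h₁ A₂ h₂
  obtain ⟨p, x, hp, hx, rfl⟩ := split A₁ h₁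
  obtain ⟨q, y, hq, hy, rfl⟩ := split A₂ h₂
  have hx2 := (mm x).1 hx.2
  have hy2 := (mm y).1 hy.2
  have o1 : B ⁅L, p⁆ q = 0 := by
    rw [hBsymm]; exact ortho _ _ hq ((mm _).1 (stab p hp).2)
  have o2 : B ⁅L, x⁆ y = 0 := by
    apply ortho _ _ _ hy2
    rw [LieHom.map_lie, hΘL, hx2]; simp
  have o3 := hBinv L p y
  have o4 : B ⁅L, p⁆ y = - B ⁅L, y⁆ p := by rw [hBsymm _ p]; linarith
  rw [lie_add, add_lie, add_lie, step4 p q hp hq, step1 x hx y hy, step3 x hx q hq,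
    ← lie_skew p y, step3 y hy p hp]
  simp only [lie_add, map_add, LinearMap.add_apply, o1, o2, o4]
  module
end
end
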